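/- arXiv:1109.1487 — 8 statements merged into one kernel-verified Lean document; each statement's English description precedes it below -/
import Mathlib

section
/- Let G be a finite simple graph with vertex set V and let A ⊆ V be arbitrary. Then for every subset B ⊆ V exactly one of the following two conditions holds: (i) there exists D ⊆ B with D ∪ Odd(D) ⊆ B and |D ∩ A| odd; (ii) there exists C ⊆ V \ B with Odd(C) ∩ B = A ∩ B. -/
open Finset

/-- The odd neighborhood of a set `D` of vertices: the set of vertices having an odd
number of neighbors in `D`. -/
def oddNbhd {V : Type*} (G : SimpleGraph V) [Fintype V] [DecidableEq V]
    [DecidableRel G.Adj] (D : Finset V) : Finset V :=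
  Finset.univ.filter fun v => Odd ((G.neighborFinset v) ∩ D).card

lemma cast_deg {V : Type*} (G : SimpleGraph V) [Fintype V] [DecidableEq V]
    [DecidableRel G.Adj] (D : Finset V) (v : V) :
    (((G.neighborFinset v) ∩ D).card : ZMod 2) = ∑ w ∈ D, if G.Adj v w then 1 else 0 := by
  rw [Finset.sum_boole]
  congr 2
  ext w
  simp [and_comm]

lemma mem_oddNbhd' {V : Type*} (G : SimpleGraph V) [Fintype V] [DecidableEq V]
    [DecidableRel G.Adj] (D : Finset V) (v : V) :
    v ∈ oddNbhd G D ↔ (∑ w ∈ D, if G.Adj v w then (1 : ZMod 2) else 0) = 1 := by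
  rw [← cast_deg, ZMod.natCast_eq_one_iff_odd]
  simp [oddNbhd]

lemma zmod2_ne (x : ZMod 2) : x ≠ 1 ↔ x = 0 := by revert x; decide

lemma zmod2_ite (x : ZMod 2) : (if x = 1 then (1 : ZMod 2) else 0) = x := by
  revert x; decide

/-- For any graph `G`, any `A ⊆ V` and any `B ⊆ V`, exactly one of the following holds:
(i) there is `D ⊆ B` with `D ∪ Odd(D) ⊆ B` and `|D ∩ A|` odd;
(ii) there is `C ⊆ V \ B` with `Odd(C) ∩ B = A ∩ B`. -/
theorem cqss_access_or_private {V : Type*} [Fintype V] [DecidableEq V]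
    (G : SimpleGraph V) [DecidableRel G.Adj] (A B : Finset V) :
    Xor' (∃ D ⊆ B, D ∪ oddNbhd G D ⊆ B ∧ Odd (D ∩ A).card)
         (∃ C ⊆ Bᶜ, oddNbhd G C ∩ B = A ∩ B) := by
  have hcard : ∀ D : Finset V, Odd (D ∩ A).card ↔
      (∑ v ∈ D, if v ∈ A then (1 : ZMod 2) else 0) = 1 := by
    intro D
    rw [← ZMod.natCast_eq_one_iff_odd, Finset.sum_boole, Finset.filter_mem_eq_inter]
  have hnot : (∃ D ⊆ B, D ∪ oddNbhd G D ⊆ B ∧ Odd (D ∩ A).card) →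
      (∃ C ⊆ Bᶜ, oddNbhd G C ∩ B = A ∩ B) → False := by
    rintro ⟨D, hDB, hD, hodd⟩ ⟨C, hCB, hC⟩
    rw [hcard] at hodd
    have h1 : (∑ v ∈ D, if v ∈ A then (1 : ZMod 2) else 0)
        = ∑ v ∈ D, ∑ w ∈ C, if G.Adj v w then 1 else 0 := by
      refine Finset.sum_congr rfl fun v hv => ?_
      have hv' : v ∈ oddNbhd G C ↔ v ∈ A := by
        have := Finset.ext_iff.1 hC v
        simpa [hDB hv] using this
      rw [← zmod2_ite (∑ w ∈ C, if G.Adj v w then 1 else 0)]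
      exact if_congr (hv'.symm.trans (mem_oddNbhd' G C v)) rfl rfl
    rw [h1, Finset.sum_comm, Finset.sum_eq_zero] at hodd
    · exact absurd hodd (by decide)
    · intro w hw
      have hwB : w ∉ B := Finset.mem_compl.1 (hCB hw)
      have : w ∉ oddNbhd G D := fun h => hwB (hD (Finset.mem_union_right _ h))
      rw [mem_oddNbhd', ← ne_eq, zmod2_ne] at this
      simpa only [G.adj_comm w] using this
  have hor : (∃ D ⊆ B, D ∪ oddNbhd G D ⊆ B ∧ Odd (D ∩ A).card) ∨
      (∃ C ⊆ Bᶜ, oddNbhd G C ∩ B = A ∩ B) := by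
    let M : Matrix V V (ZMod 2) := fun v w => if v ∈ B ∧ w ∉ B ∧ G.Adj v w then 1 else 0
    let a : V → ZMod 2 := fun v => if v ∈ A ∧ v ∈ B then 1 else 0
    by_cases ha : a ∈ LinearMap.range M.mulVecLin
    · right
      obtain ⟨c, hc⟩ := ha
      refine ⟨Finset.univ.filter fun w => w ∉ B ∧ c w = 1, ?_, ?_⟩
      · intro w; simp +contextual
      · ext v
        by_cases hv : v ∈ B
        · have := congrFun hc v
          simp only [Finset.mem_inter, hv, and_true, mem_oddNbhd']
          have h2 : (∑ w with w ∉ B ∧ c w = 1, if G.Adj v w then (1 : ZMod 2) else 0) = a v := by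
            rw [← this, Finset.sum_filter]
            rw [Matrix.mulVecLin_apply]
            simp only [Matrix.mulVec, dotProduct, M]
            refine Finset.sum_congr rfl fun w _ => ?_
            rw [← zmod2_ite (c w)]
            by_cases h : c w = 1 <;> by_cases h' : w ∈ B <;> simp [h, h', hv]
          rw [h2]
          simp [a, hv]
        · simp [hv]
    · left
      obtain ⟨f, hf, hker⟩ := Submodule.exists_le_ker_of_notMem ha
      have hfx : ∀ x : V → ZMod 2, f x = ∑ v, x v * f (Pi.single v 1) := by
        intro x
        rw [LinearMap.pi_apply_eq_sum_univ f x]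
        refine Finset.sum_congr rfl fun v _ => ?_
        rw [smul_eq_mul]
        congr 2
        ext j
        simp [Pi.single_apply, eq_comm]
      refine ⟨Finset.univ.filter fun v => v ∈ B ∧ f (Pi.single v 1) = 1, ?_, ?_, ?_⟩
      · intro w; simp +contextual
      · refine Finset.union_subset (by intro w; simp +contextual) ?_
        intro w hw
        by_contra hwB
        rw [mem_oddNbhd'] at hw
        have h0 : f (M.mulVecLin (Pi.single w 1)) = 0 := hker ⟨_, rfl⟩
        rw [hfx] at h0
        have : (0 : ZMod 2) = 1 := by
          refine h0.symm.trans (Eq.trans ?_ hw)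
          rw [Finset.sum_filter]
          refine Finset.sum_congr rfl fun v _ => ?_
          have hm : M.mulVecLin (Pi.single w 1) v = M v w := by
            simp [Matrix.mulVecLin_apply]
          rw [hm]
          generalize f (Pi.single v 1) = y
          by_cases h : y = 1
          · by_cases h' : v ∈ B <;> simp [h, h', hwB, M, G.adj_comm w]
          · rw [← ne_eq, zmod2_ne] at h
            simp [h]
        exact absurd this (by decide)
      · rw [hcard]
        have h1 : f a = 1 := by
          by_contra h
          exact hf ((zmod2_ne _).1 h)
        refine Eq.trans ?_ h1
        rw [hfx, Finset.sum_filter]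
        refine Finset.sum_congr rfl fun v _ => ?_
        generalize f (Pi.single v 1) = y
        by_cases h : y = 1
        · by_cases h' : v ∈ B <;> simp [h, h', a]
        · rw [← ne_eq, zmod2_ne] at h
          simp [h]
  rcases hor with h | h
  · exact Or.inl ⟨h, fun h' => hnot h h'⟩
  · exact Or.inr ⟨h, fun h' => hnot h' h⟩
end

section
/- Let G be a finite simple graph with vertex set V, and for Y ⊆ V let q(Y) denote the number of edges of G having both endpoints in Y. Then for all X, D ⊆ V one has q(X Δ D) ≡ q(X) + q(D) + |X ∩ Odd(D)| (mod 2), where Δ denotes symmetric difference. (This identity underlies the graph-state fixpoint property X_D Z_{Odd(D)} |G⟩ = ± |G⟩.) -/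
open Finset

/-- `q(Y)`: the number of edges of `G` with both endpoints in `Y`. -/
def edgesInside {V : Type*} (G : SimpleGraph V) [Fintype V] [DecidableEq V]
    [DecidableRel G.Adj] (Y : Finset V) : ℕ :=
  (Y.sym2 ∩ G.edgeFinset).card

lemma aux_q {V : Type*} [Fintype V] [DecidableEq V]
    (G : SimpleGraph V) [DecidableRel G.Adj] (Y : Finset V) :
    (edgesInside G Y : ZMod 2) = ∑ e ∈ G.edgeFinset, if e ∈ Y.sym2 then 1 else 0 := by
  unfold edgesInside
  rw [Finset.inter_comm, ← Finset.filter_mem_eq_inter, Finset.card_filter]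
  push_cast
  rfl

lemma aux_B {V : Type*} [Fintype V] [DecidableEq V]
    (G : SimpleGraph V) [DecidableRel G.Adj] (X D : Finset V) :
    ((X ∩ oddNbhd G D).card : ZMod 2) =
      ∑ p ∈ (univ : Finset (V × V)).filter (fun p => G.Adj p.1 p.2),
        if p.1 ∈ X ∧ p.2 ∈ D then 1 else 0 := by
  rw [← Finset.filter_mem_eq_inter, Finset.card_filter, Finset.sum_filter,
    Fintype.sum_prod_type, ← Finset.sum_subset (Finset.subset_univ X)]
  · push_cast
    refine Finset.sum_congr rfl fun x hx => ?_
    have h1 : (∑ y : V, if G.Adj x y then (if x ∈ X ∧ y ∈ D then (1 : ZMod 2) else 0) else 0)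
        = ((G.neighborFinset x ∩ D).card : ZMod 2) := by
      have : G.neighborFinset x ∩ D = univ.filter (fun y => G.Adj x y ∧ y ∈ D) := by
        ext y; simp
      rw [this, Finset.card_filter]
      push_cast
      refine Finset.sum_congr rfl fun y _ => ?_
      by_cases h : G.Adj x y <;> simp [h, hx]
    rw [h1]
    by_cases h : Odd (G.neighborFinset x ∩ D).card
    · rw [(ZMod.natCast_eq_one_iff_odd).2 h]
      simp [oddNbhd, h]
    · rw [(ZMod.natCast_eq_zero_iff_even).2 (Nat.not_odd_iff_even.1 h)]
      simp [oddNbhd, h]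
  · intro x _ hx
    simp [hx]

/-- `q(X Δ D) ≡ q(X) + q(D) + |X ∩ Odd(D)| (mod 2)`. -/
theorem edgesInside_symmDiff_parity {V : Type*} [Fintype V] [DecidableEq V]
    (G : SimpleGraph V) [DecidableRel G.Adj] (X D : Finset V) :
    edgesInside G (symmDiff X D) % 2
      = (edgesInside G X + edgesInside G D + (X ∩ oddNbhd G D).card) % 2 := by
  change _ ≡ _ [MOD 2]
  rw [← ZMod.natCast_eq_natCast_iff]
  push_cast
  rw [aux_q, aux_q, aux_q, aux_B,
    ← Finset.sum_fiberwise_of_maps_to (t := G.edgeFinset) (g := fun p : V × V => s(p.1, p.2))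
      (by intro p hp; simpa using hp),
    ← Finset.sum_add_distrib, ← Finset.sum_add_distrib]
  refine Finset.sum_congr rfl fun e he => ?_
  induction e using Sym2.ind with
  | _ u v =>
    have huv : G.Adj u v := by simpa using he
    have hf : (univ.filter (fun p : V × V => G.Adj p.1 p.2)).filter
        (fun p => s(p.1, p.2) = s(u, v)) = {(u, v), (v, u)} := by
      ext ⟨a, b⟩
      simp only [mem_filter, mem_univ, true_and, Sym2.eq_iff, mem_insert, mem_singleton,
        Prod.mk.injEq]
      constructor
      · exact fun h => h.2
      · rintro (⟨rfl, rfl⟩ | ⟨rfl, rfl⟩)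
        · exact ⟨huv, Or.inl ⟨rfl, rfl⟩⟩
        · exact ⟨huv.symm, Or.inr ⟨rfl, rfl⟩⟩
    have hne : (u, v) ≠ (v, u) := by
      intro h
      exact huv.ne (Prod.mk.inj h).1
    rw [hf, Finset.sum_pair hne]
    simp only [Finset.mk_mem_sym2_iff, Finset.mem_symmDiff]
    by_cases h1 : u ∈ X <;> by_cases h2 : v ∈ X <;> by_cases h3 : u ∈ D <;>
      by_cases h4 : v ∈ D <;> simp [h1, h2, h3, h4] <;> decide
end

section
/- Let G be a finite simple graph with vertex set V and let Gᶜ denote its complement graph. For any D ⊆ V: if |D| is odd then Odd_{Gᶜ}(D) = Odd_G(D) Δ (V \ D), and if |D| is even then Odd_{Gᶜ}(D) = Odd_G(D) Δ D, where Δ denotes symmetric difference and Odd_H is the odd neighborhood taken in the graph H. -/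
open Finset

theorem card_split_aux {V : Type*} [Fintype V] [DecidableEq V]
    (G : SimpleGraph V) [DecidableRel G.Adj] (D : Finset V) (v : V) :
    D.card = (G.neighborFinset v ∩ D).card + (Gᶜ.neighborFinset v ∩ D).card
      + (if v ∈ D then 1 else 0) := by
  have h3 : (if v ∈ D then 1 else 0) = (({v} : Finset V) ∩ D).card := by
    by_cases h : v ∈ D <;> simp [h]
  rw [h3, ← Finset.card_union_of_disjoint, ← Finset.card_union_of_disjoint]
  · congr 1
    ext w
    simp only [mem_union, mem_inter, SimpleGraph.mem_neighborFinset, SimpleGraph.compl_adj,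
      mem_singleton]
    grind
  · rw [Finset.disjoint_left]
    intro w
    simp only [mem_union, mem_inter, SimpleGraph.mem_neighborFinset, SimpleGraph.compl_adj,
      mem_singleton]
    have := G.irrefl (v := v)
    grind
  · rw [Finset.disjoint_left]
    intro w
    simp only [mem_inter, SimpleGraph.mem_neighborFinset, SimpleGraph.compl_adj]
    grind

/-- Odd neighborhoods in the complement graph: if `|D|` is odd then
`Odd_{Gᶜ}(D) = Odd_G(D) Δ (V \ D)`, and if `|D|` is even then
`Odd_{Gᶜ}(D) = Odd_G(D) Δ D`. -/
theorem oddNbhd_compl {V : Type*} [Fintype V] [DecidableEq V]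
    (G : SimpleGraph V) [DecidableRel G.Adj] (D : Finset V) :
    (Odd D.card → oddNbhd Gᶜ D = symmDiff (oddNbhd G D) Dᶜ) ∧
    (Even D.card → oddNbhd Gᶜ D = symmDiff (oddNbhd G D) D) := by
  constructor <;> intro h <;> ext v <;> have hs := card_split_aux G D v <;>
    simp only [oddNbhd, mem_symmDiff, mem_filter, mem_univ, true_and, mem_compl,
      Nat.odd_iff, Nat.even_iff] at h ⊢ <;>
    by_cases hv : v ∈ D <;> simp only [hv, if_true, if_false, not_true_eq_false,
      not_false_eq_true, and_true, and_false, true_and, false_and, or_false, false_or] at hs ⊢ <;> omega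
end

section
/- Let G be a finite simple graph with vertex set V, let B ⊆ V, and let D ⊆ B be a set of odd cardinality such that the odd neighborhood of D in the complement graph Gᶜ satisfies Odd_{Gᶜ}(D) ⊆ B. Then every vertex outside B lies in the odd neighborhood of D in G, i.e. V \ B ⊆ Odd_G(D). -/
open Finset

/-- If `D ⊆ B` has odd cardinality and its odd neighborhood in the complement graph is
contained in `B`, then every vertex outside `B` is in the odd neighborhood of `D` in `G`. -/
theorem compl_oddNbhd_subset {V : Type*} [Fintype V] [DecidableEq V]
    (G : SimpleGraph V) [DecidableRel G.Adj] (B D : Finset V)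
    (hDB : D ⊆ B) (hodd : Odd D.card) (h : oddNbhd Gᶜ D ⊆ B) :
    Bᶜ ⊆ oddNbhd G D := by
  intro v hv
  have hvB : v ∉ B := Finset.mem_compl.mp hv
  have hvD : v ∉ D := fun hd => hvB (hDB hd)
  have hn : ¬ Odd ((Gᶜ.neighborFinset v) ∩ D).card := fun ho =>
    hvB (h (by unfold oddNbhd; exact Finset.mem_filter.mpr ⟨Finset.mem_univ _, ho⟩))
  have e : (Gᶜ.neighborFinset v) ∩ D = D \ (G.neighborFinset v) := by
    ext w
    simp only [Finset.mem_inter, SimpleGraph.mem_neighborFinset, SimpleGraph.compl_adj,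
      Finset.mem_sdiff]
    constructor
    · rintro ⟨⟨_, h1⟩, h2⟩
      exact ⟨h2, h1⟩
    · rintro ⟨h2, h1⟩
      exact ⟨⟨fun hw => hvD (hw ▸ h2), h1⟩, h2⟩
  have hc := Finset.card_sdiff_add_card_inter D (G.neighborFinset v)
  rw [e] at hn
  unfold oddNbhd
  refine Finset.mem_filter.mpr ⟨Finset.mem_univ _, ?_⟩
  rw [Finset.inter_comm]
  rw [Nat.odd_iff] at *
  omega
end

section
/- Let G be a finite simple graph with vertex set V, |V| = n, and let B ⊆ V with |B| = k. Suppose there exists D ⊆ B with |D| odd and Odd(D) ⊆ B, and there exists C ⊆ B with V \ B ⊆ Odd(C). Then there exists X ⊆ B with 3·|X| ≤ 2·(n − k + 1) such that either (|X| is odd and Odd(X) ⊆ B) or (V \ B ⊆ Odd(X)). -/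
open Finset

theorem odd_card_symmDiff_aux {V : Type*} [DecidableEq V] (X Y : Finset V) :
    Odd (symmDiff X Y).card ↔ ¬ (Odd X.card ↔ Odd Y.card) := by
  have h1 : (symmDiff X Y).card = (X \ Y).card + (Y \ X).card := by
    rw [symmDiff_def, Finset.sup_eq_union, Finset.card_union_of_disjoint]
    exact disjoint_sdiff_sdiff
  have h2 := Finset.card_sdiff_add_card_inter X Y
  have h3 := Finset.card_sdiff_add_card_inter Y X
  rw [Finset.inter_comm] at h3
  simp only [Nat.odd_iff]
  omega

theorem mem_oddNbhd_symmDiff_aux {V : Type*} [Fintype V] [DecidableEq V]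
    (G : SimpleGraph V) [DecidableRel G.Adj] (X Y : Finset V) (v : V) :
    v ∈ oddNbhd G (symmDiff X Y) ↔ ¬ (v ∈ oddNbhd G X ↔ v ∈ oddNbhd G Y) := by
  simp only [oddNbhd, Finset.mem_filter, Finset.mem_univ, true_and]
  rw [← odd_card_symmDiff_aux]
  have : G.neighborFinset v ∩ symmDiff X Y
      = symmDiff (G.neighborFinset v ∩ X) (G.neighborFinset v ∩ Y) := by
    ext w
    simp only [Finset.mem_inter, Finset.mem_symmDiff]
    tauto
  rw [this]

theorem exists_dep_aux {V : Type*} [Fintype V] [DecidableEq V]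
    (G : SimpleGraph V) [DecidableRel G.Adj] (B S : Finset V)
    (hS : Bᶜ.card + 1 < S.card) :
    ∃ Z ⊆ S, Z.Nonempty ∧ ¬ Odd Z.card ∧ ∀ v ∉ B, v ∉ oddNbhd G Z := by
  have hc : (Bᶜ.powerset ×ˢ (Finset.univ : Finset Bool)).card < S.powerset.card := by
    rw [Finset.card_product, Finset.card_powerset, Finset.card_powerset]
    simp only [Finset.card_univ, Fintype.card_bool]
    rw [← pow_succ]
    exact Nat.pow_lt_pow_right (by norm_num) hS
  obtain ⟨P, hP, Q, hQ, hne, he⟩ := Finset.exists_ne_map_eq_of_card_lt_of_maps_to hc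
    (f := fun X => (oddNbhd G X ∩ Bᶜ, decide (Odd X.card)))
    (by
      intro X _
      exact Finset.mem_coe.2 (Finset.mem_product.2
        ⟨Finset.mem_powerset.2 Finset.inter_subset_right, Finset.mem_univ _⟩))
  rw [Finset.mem_powerset] at hP hQ
  simp only [Prod.mk.injEq, decide_eq_decide] at he
  refine ⟨symmDiff P Q, ?_, ?_, ?_, ?_⟩
  · intro w hw
    rw [Finset.mem_symmDiff] at hw
    rcases hw with h | h
    · exact hP h.1
    · exact hQ h.1
  · rw [Finset.nonempty_iff_ne_empty]
    intro h
    exact hne (symmDiff_eq_bot.1 h)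
  · rw [odd_card_symmDiff_aux]
    exact not_not.2 he.2
  · intro v hv
    rw [mem_oddNbhd_symmDiff_aux, not_not]
    have := Finset.ext_iff.1 he.1 v
    simpa [hv] using this

theorem small_union_aux {V : Type*} [Fintype V] [DecidableEq V]
    (G : SimpleGraph V) [DecidableRel G.Adj] (B : Finset V) (N : ℕ) :
    ∀ D C : Finset V, (C ∪ D).card ≤ N → D ⊆ B → Odd D.card → (∀ v ∉ B, v ∉ oddNbhd G D) →
      C ⊆ B → (∀ v ∉ B, v ∈ oddNbhd G C) →
      ∃ D C : Finset V, (C ∪ D).card ≤ Bᶜ.card + 1 ∧ D ⊆ B ∧ Odd D.card ∧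
        (∀ v ∉ B, v ∉ oddNbhd G D) ∧ C ⊆ B ∧ (∀ v ∉ B, v ∈ oddNbhd G C) := by
  induction N with
  | zero =>
    intro D C h h1 h2 h3 h4 h5
    exact ⟨D, C, by omega, h1, h2, h3, h4, h5⟩
  | succ N ih =>
    intro D C h h1 h2 h3 h4 h5
    by_cases hS : (C ∪ D).card ≤ Bᶜ.card + 1
    · exact ⟨D, C, hS, h1, h2, h3, h4, h5⟩
    obtain ⟨Z, hZ, ⟨z, hz⟩, hZo, hZv⟩ := exists_dep_aux G B (C ∪ D) (by omega)
    have hZB : Z ⊆ B := hZ.trans (Finset.union_subset h4 h1)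
    have sub : ∀ X ⊆ C ∪ D, ∀ S, S ⊆ X → symmDiff S Z ⊆ C ∪ D := by
      intro X hX S hSX w hw
      rw [Finset.mem_symmDiff] at hw
      rcases hw with h | h
      · exact hX (hSX h.1)
      · exact hZ h.1
    have subB : ∀ S ⊆ B, symmDiff S Z ⊆ B := by
      intro S hSX w hw
      rw [Finset.mem_symmDiff] at hw
      rcases hw with h | h
      · exact hSX h.1
      · exact hZB h.1
    -- choose new sets avoiding z
    have key : ∀ S ⊆ C ∪ D, ∃ S' ⊆ C ∪ D, z ∉ S' ∧ (S' = S ∨ S' = symmDiff S Z) := by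
      intro S hS
      by_cases hzS : z ∈ S
      · exact ⟨symmDiff S Z, sub S hS S subset_rfl, by simp [Finset.mem_symmDiff, hzS, hz],
          Or.inr rfl⟩
      · exact ⟨S, hS, hzS, Or.inl rfl⟩
    obtain ⟨D', hD', hzD, hDe⟩ := key D Finset.subset_union_right
    obtain ⟨C', hC', hzC, hCe⟩ := key C Finset.subset_union_left
    have hlt : (C' ∪ D').card < (C ∪ D).card := by
      apply Finset.card_lt_card
      refine ⟨Finset.union_subset hC' hD', fun hh => ?_⟩
      have := hh (hZ hz)
      simp [hzC, hzD] at this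
    refine ih D' C' (by omega) ?_ ?_ ?_ ?_ ?_
    · rcases hDe with rfl | rfl
      · exact h1
      · exact subB D h1
    · rcases hDe with rfl | rfl
      · exact h2
      · rw [odd_card_symmDiff_aux]; tauto
    · intro v hv
      rcases hDe with rfl | rfl
      · exact h3 v hv
      · have := h3 v hv
        have := hZv v hv
        rw [mem_oddNbhd_symmDiff_aux]; tauto
    · rcases hCe with rfl | rfl
      · exact h4
      · exact subB C h4
    · intro v hv
      rcases hCe with rfl | rfl
      · exact h5 v hv
      · have := h5 v hv
        have := hZv v hv
        rw [mem_oddNbhd_symmDiff_aux]; tauto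

/-- If `B` (of size `k` in a graph on `n` vertices) contains an odd set `D` with
`Odd(D) ⊆ B` and a set `C` with `V \ B ⊆ Odd(C)`, then it contains a set `X` with
`|X| ≤ (2/3)(n − k + 1)` which is of one of these two kinds. -/
theorem small_oddwise_or_evenwise {V : Type*} [Fintype V] [DecidableEq V]
    (G : SimpleGraph V) [DecidableRel G.Adj] (n k : ℕ)
    (hn : Fintype.card V = n) (B : Finset V) (hB : B.card = k)
    (hD : ∃ D ⊆ B, Odd D.card ∧ oddNbhd G D ⊆ B)
    (hC : ∃ C ⊆ B, Bᶜ ⊆ oddNbhd G C) :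
    ∃ X ⊆ B, 3 * X.card ≤ 2 * (n - k + 1) ∧
      ((Odd X.card ∧ oddNbhd G X ⊆ B) ∨ Bᶜ ⊆ oddNbhd G X) := by
  obtain ⟨D₀, hD1, hD2, hD3⟩ := hD
  obtain ⟨C₀, hC1, hC2⟩ := hC
  obtain ⟨D, C, hle, h1, h2, h3, h4, h5⟩ := small_union_aux G B _ D₀ C₀ le_rfl hD1 hD2
    (fun v hv h => hv (hD3 h)) hC1 (fun v hv => hC2 (Finset.mem_compl.2 hv))
  rw [Finset.card_compl, hn, hB] at hle
  have e1 : (symmDiff C D).card = (C \ D).card + (D \ C).card := by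
    rw [symmDiff_def, Finset.sup_eq_union, Finset.card_union_of_disjoint]
    exact disjoint_sdiff_sdiff
  have e2 := Finset.card_sdiff_add_card_inter C D
  have e3 := Finset.card_sdiff_add_card_inter D C
  rw [Finset.inter_comm] at e3
  have e4 := Finset.card_union_add_card_inter C D
  have hcases : 3 * D.card ≤ 2 * (n - k + 1) ∨ 3 * C.card ≤ 2 * (n - k + 1) ∨
      3 * (symmDiff C D).card ≤ 2 * (n - k + 1) := by omega
  rcases hcases with h | h | h
  · refine ⟨D, h1, h, Or.inl ⟨h2, fun v hv => ?_⟩⟩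
    by_contra hvB
    exact h3 v hvB hv
  · exact ⟨C, h4, h, Or.inr fun v hv => h5 v (Finset.mem_compl.1 hv)⟩
  · refine ⟨symmDiff C D, ?_, h, Or.inr fun v hv => ?_⟩
    · intro w hw
      rw [Finset.mem_symmDiff] at hw
      rcases hw with h | h
      · exact h4 h.1
      · exact h1 h.1
    · have hv := Finset.mem_compl.1 hv
      have := h5 v hv
      have := h3 v hv
      rw [mem_oddNbhd_symmDiff_aux]; tauto
end

section
/- Let G be a finite simple graph with vertex set V, |V| = n, and let B ⊆ V with |B| = k, where 2k ≥ n. Then the number of subsets D ⊆ B satisfying Odd(D) ⊆ B is at least 2^{2k−n}. -/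
open Finset

theorem odd_inter_symmDiff_aux {V : Type*} [DecidableEq V] (N D E : Finset V) :
    Odd (N ∩ symmDiff D E).card ↔ ¬ (Odd (N ∩ D).card ↔ Odd (N ∩ E).card) := by
  have h1 : (N ∩ D).card = ((N ∩ D) ∩ E).card + ((N ∩ D) \ E).card :=
    (card_inter_add_card_sdiff _ _).symm
  have h2 : (N ∩ E).card = ((N ∩ E) ∩ D).card + ((N ∩ E) \ D).card :=
    (card_inter_add_card_sdiff _ _).symm
  have h3 : (N ∩ E) ∩ D = (N ∩ D) ∩ E := by
    ext x; simp only [mem_inter]; tauto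
  have h4 : N ∩ symmDiff D E = ((N ∩ D) \ E) ∪ ((N ∩ E) \ D) := by
    ext x; simp only [mem_inter, mem_symmDiff, mem_union, mem_sdiff]; tauto
  have h5 : Disjoint ((N ∩ D) \ E) ((N ∩ E) \ D) := by
    rw [Finset.disjoint_left]; intro x; simp only [mem_inter, mem_sdiff]; tauto
  rw [h4, card_union_of_disjoint h5, h1, h2, h3]
  simp only [Nat.odd_iff]
  omega

/-- If `|B| = k` and `2k ≥ n`, then `B` contains at least `2^{2k−n}` subsets `D`
with `Odd(D) ⊆ B`. -/
theorem card_oddwise_ge {V : Type*} [Fintype V] [DecidableEq V]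
    (G : SimpleGraph V) [DecidableRel G.Adj] (n k : ℕ)
    (hn : Fintype.card V = n) (hk : n ≤ 2 * k)
    (B : Finset V) (hB : B.card = k) :
    2 ^ (2 * k - n) ≤ (B.powerset.filter fun D => oddNbhd G D ⊆ B).card := by
  have hkn : k ≤ n := by rw [← hB, ← hn]; exact card_le_univ B
  have hmaps : ∀ D ∈ B.powerset, oddNbhd G D \ B ∈ (Bᶜ).powerset := by
    intro D _
    rw [mem_powerset]
    intro x hx
    simp only [mem_sdiff] at hx
    simpa using hx.2
  obtain ⟨T, -, hT⟩ := exists_le_card_fiber_of_mul_le_card_of_maps_to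
    (n := 2 ^ (2 * k - n)) hmaps ⟨∅, empty_mem_powerset _⟩ (by
      rw [card_powerset, card_powerset, card_compl, hB, hn, ← pow_add]
      exact Nat.pow_le_pow_right (by norm_num) (by omega))
  refine hT.trans ?_
  rcases (B.powerset.filter fun D => oddNbhd G D \ B = T).eq_empty_or_nonempty with h | ⟨D₀, h₀⟩
  · rw [h]; simp
  rw [mem_filter, mem_powerset] at h₀
  refine card_le_card_of_injOn (fun D => symmDiff D D₀) ?_
    (fun _ _ _ _ h => symmDiff_left_injective D₀ h)
  intro D hD
  simp only [coe_filter, Set.mem_setOf_eq, mem_powerset] at hD ⊢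
  refine ⟨?_, ?_⟩
  · intro x hx
    rw [mem_symmDiff] at hx
    rcases hx with hx | hx
    · exact hD.1 hx.1
    · exact h₀.1 hx.1
  · intro x hx
    by_contra hxB
    have he := Finset.ext_iff.1 (hD.2.trans h₀.2.symm) x
    simp only [oddNbhd, mem_sdiff, mem_filter, mem_univ, true_and, hxB, not_false_eq_true,
      and_true] at he hx
    exact (odd_inter_symmDiff_aux _ _ _).1 hx he
end

section
/- Let G be a finite simple graph with vertex set V, |V| = n, and let k ≤ n. Suppose that every B ⊆ V with |B| = k is accessing, i.e. contains a subset D with |D| odd and Odd(D) ⊆ B. Then for every C ⊆ V one has |C ∪ Even(C)| ≥ n − k + 1, where Even(C) = {v ∈ V : |N(v) ∩ C| is even}. -/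
open Finset

/-- The even neighborhood of a set `C` of vertices: the set of vertices having an even
number of neighbors in `C`. -/
def evenNbhd {V : Type*} (G : SimpleGraph V) [Fintype V] [DecidableEq V]
    [DecidableRel G.Adj] (C : Finset V) : Finset V :=
  Finset.univ.filter fun v => Even ((G.neighborFinset v) ∩ C).card

/-- If every set of `k` vertices is accessing, then `|C ∪ Even(C)| ≥ n − k + 1`
for every set `C`. -/
theorem card_union_evenNbhd_ge {V : Type*} [Fintype V] [DecidableEq V]
    (G : SimpleGraph V) [DecidableRel G.Adj] (n k : ℕ)
    (hn : Fintype.card V = n) (hk : k ≤ n)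
    (hacc : ∀ B : Finset V, B.card = k →
      ∃ D ⊆ B, Odd D.card ∧ oddNbhd G D ⊆ B) :
    ∀ C : Finset V, n - k + 1 ≤ (C ∪ evenNbhd G C).card := by
  intro C
  by_contra hlt
  have hc : k ≤ (C ∪ evenNbhd G C)ᶜ.card := by
    rw [Finset.card_compl, hn]
    omega
  obtain ⟨B, hB, hBk⟩ := Finset.exists_subset_card_eq hc
  obtain ⟨D, hD, hodd, hDB⟩ := hacc B hBk
  have h1 : ∀ v ∈ D, Odd ((G.neighborFinset v) ∩ C).card := by
    intro v hv
    have := hB (hD hv)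
    simp only [evenNbhd, Finset.mem_compl, Finset.mem_union, Finset.mem_filter,
      Finset.mem_univ, true_and, not_or, Nat.not_even_iff_odd] at this
    exact this.2
  have h2 : ∀ v ∈ C, ¬ Odd ((G.neighborFinset v) ∩ D).card := by
    intro v hv ho
    have hvB : v ∈ B := hDB (by simp [oddNbhd, ho])
    have := hB hvB
    simp only [Finset.mem_compl, Finset.mem_union, not_or] at this
    exact this.1 hv
  have hsum : ∑ v ∈ D, ((G.neighborFinset v) ∩ C).card
      = ∑ v ∈ C, ((G.neighborFinset v) ∩ D).card := by
    have := Finset.sum_card_bipartiteAbove_eq_sum_card_bipartiteBelow (s := D) (t := C) G.Adj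
    convert this using 3 with v hv v hv
    · ext w
      simp [Finset.bipartiteAbove, and_comm]
    · ext w
      simp [Finset.bipartiteBelow, and_comm, G.adj_comm]
  have ho : Odd (∑ v ∈ D, ((G.neighborFinset v) ∩ C).card) := by
    rw [Finset.odd_sum_iff_odd_card_odd, Finset.filter_true_of_mem h1]
    exact hodd
  rw [hsum, Finset.odd_sum_iff_odd_card_odd, Finset.filter_false_of_mem h2] at ho
  simp at ho
end

section
/- There exists an integer n0 such that for all n ≥ n0 and all integers k: if some finite simple graph on n vertices combinatorially realizes a ((k,n)) threshold scheme, then 314·k > 159·n (equivalently k > n/2 + n/157). -/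
open Finset

/-- `B` is accessing: some `D ⊆ B` of odd cardinality has `Odd(D) ⊆ B`. -/
def accessing {V : Type*} (G : SimpleGraph V) [Fintype V] [DecidableEq V]
    [DecidableRel G.Adj] (B : Finset V) : Prop :=
  ∃ D ⊆ B, Odd D.card ∧ oddNbhd G D ⊆ B

/-- `B` is strongly accessing: it is accessing and moreover some `C ⊆ B` has
`V \ B ⊆ Odd(C)`. -/
def stronglyAccessing {V : Type*} (G : SimpleGraph V) [Fintype V] [DecidableEq V]
    [DecidableRel G.Adj] (B : Finset V) : Prop :=
  accessing G B ∧ ∃ C ⊆ B, Bᶜ ⊆ oddNbhd G C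

/-- `G` (on `n = |V|` vertices) combinatorially realizes a `((k,n))` threshold scheme:
every set of `k` vertices is strongly accessing and no set of `n − k` vertices is
accessing. -/
def realizesThreshold {V : Type*} (G : SimpleGraph V) [Fintype V] [DecidableEq V]
    [DecidableRel G.Adj] (k : ℕ) : Prop :=
  (∀ B : Finset V, B.card = k → stronglyAccessing G B) ∧
  (∀ B : Finset V, B.card = Fintype.card V - k → ¬ accessing G B)

theorem par_symmDiff {V : Type*} [DecidableEq V] (A B : Finset V) :
    Odd (symmDiff A B).card ↔ (Odd A.card ↔ ¬ Odd B.card) := by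
  have h1 : (symmDiff A B).card = (A \ B).card + (B \ A).card := by
    rw [symmDiff_def, Finset.sup_eq_union, Finset.card_union_of_disjoint]
    exact disjoint_sdiff_sdiff
  have h2 := Finset.card_sdiff_add_card_inter A B
  have h3 := Finset.card_sdiff_add_card_inter B A
  rw [Finset.inter_comm B A] at h3
  simp only [Nat.odd_iff]
  omega

theorem mem_oddNbhd_symmDiff {V : Type*} (G : SimpleGraph V) [Fintype V] [DecidableEq V]
    [DecidableRel G.Adj] (D E : Finset V) (v : V) :
    v ∈ oddNbhd G (symmDiff D E) ↔ (v ∈ oddNbhd G D ↔ ¬ v ∈ oddNbhd G E) := by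
  have : G.neighborFinset v ∩ symmDiff D E
      = symmDiff (G.neighborFinset v ∩ D) (G.neighborFinset v ∩ E) := by
    ext x
    simp only [Finset.mem_inter, Finset.mem_symmDiff]
    tauto
  simp only [oddNbhd, Finset.mem_filter, Finset.mem_univ, true_and, this, par_symmDiff]

theorem mem_symmDiff_iff_not {V : Type*} [DecidableEq V] (D E : Finset V) (v : V) :
    v ∈ symmDiff D E ↔ (v ∈ D ↔ ¬ v ∈ E) := by
  simp only [Finset.mem_symmDiff]
  tauto

/-- odd sets `D` with `D ∪ Odd(D) ⊆ T` -/
def oddIn {V : Type*} (G : SimpleGraph V) [Fintype V] [DecidableEq V]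
    [DecidableRel G.Adj] (T : Finset V) : Finset (Finset V) :=
  Finset.univ.filter fun D => D ⊆ T ∧ Odd D.card ∧ oddNbhd G D ⊆ T

theorem mem_oddIn {V : Type*} (G : SimpleGraph V) [Fintype V] [DecidableEq V]
    [DecidableRel G.Adj] (T D : Finset V) :
    D ∈ oddIn G T ↔ D ⊆ T ∧ Odd D.card ∧ oddNbhd G D ⊆ T := by
  simp [oddIn]

theorem oddIn_erase {V : Type*} (G : SimpleGraph V) [Fintype V] [DecidableEq V]
    [DecidableRel G.Adj] (T D : Finset V) (v : V) :
    D ∈ oddIn G (T.erase v) ↔ D ∈ oddIn G T ∧ v ∉ D ∧ v ∉ oddNbhd G D := by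
  simp only [mem_oddIn, Finset.subset_erase]
  tauto

theorem symm3_mem {V : Type*} (G : SimpleGraph V) [Fintype V] [DecidableEq V]
    [DecidableRel G.Adj] (T A B C : Finset V) (hA : A ∈ oddIn G T) (hB : B ∈ oddIn G T)
    (hC : C ∈ oddIn G T) : symmDiff A (symmDiff B C) ∈ oddIn G T := by
  rw [mem_oddIn] at *
  refine ⟨?_, ?_, ?_⟩
  · intro x hx
    have a := @hA.1 x
    have b := @hB.1 x
    have c := @hC.1 x
    simp only [mem_symmDiff_iff_not] at hx
    tauto
  · simp only [par_symmDiff]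
    have := hA.2.1
    have := hB.2.1
    have := hC.2.1
    tauto
  · intro x hx
    have a := @hA.2.2 x
    have b := @hB.2.2 x
    have c := @hC.2.2 x
    simp only [mem_oddNbhd_symmDiff] at hx
    tauto

theorem four_mul {V : Type*} (G : SimpleGraph V) [Fintype V] [DecidableEq V]
    [DecidableRel G.Adj] (T : Finset V) (v : V) (hne : (oddIn G (T.erase v)).Nonempty) :
    (oddIn G T).card ≤ 4 * (oddIn G (T.erase v)).card := by
  obtain ⟨E, hE⟩ := hne
  have hE' := (oddIn_erase G T E v).1 hE
  let f : Finset V → Bool × Bool := fun D => (decide (v ∈ D), decide (v ∈ oddNbhd G D))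
  have key : ∀ b ∈ (Finset.univ : Finset (Bool × Bool)),
      ((oddIn G T).filter fun D => f D = b).card ≤ (oddIn G (T.erase v)).card := by
    intro b _
    rcases ((oddIn G T).filter fun D => f D = b).eq_empty_or_nonempty with h | ⟨D0, h0⟩
    · rw [h]; simp
    · rw [Finset.mem_filter] at h0
      apply Finset.card_le_card_of_injOn (fun D => symmDiff D (symmDiff D0 E))
      · intro D hD
        have hD := Finset.mem_filter.1 (Finset.mem_coe.1 hD)
        have hf : f D = f D0 := hD.2.trans h0.2.symm
        simp only [f, Prod.mk.injEq, decide_eq_decide] at hf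
        apply Finset.mem_coe.2
        rw [oddIn_erase]
        refine ⟨symm3_mem G T _ _ _ hD.1 h0.1 hE'.1, ?_, ?_⟩
        · simp only [mem_symmDiff_iff_not]
          tauto
        · simp only [mem_oddNbhd_symmDiff]
          tauto
      · intro A _ B _ h
        exact symmDiff_left_injective _ h
  have h := Finset.card_le_mul_card_image_of_maps_to (s := oddIn G T) (f := f)
    (t := Finset.univ) (fun _ _ => Finset.mem_univ _) _ key
  simp only [Finset.card_univ, Fintype.card_prod, Fintype.card_bool] at h
  omega

/-- For all large enough `n`, any graph on `n` vertices combinatorially realizing a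
`((k,n))` threshold scheme satisfies `314·k > 159·n` (i.e. `k > n/2 + n/157`). -/
theorem threshold_lower_bound :
    ∃ n0 : ℕ, ∀ n k : ℕ, n0 ≤ n →
      ∀ (V : Type) [Fintype V] [DecidableEq V]
        (G : SimpleGraph V) [DecidableRel G.Adj],
        Fintype.card V = n → realizesThreshold G k → 159 * n < 314 * k := by
  refine ⟨1, ?_⟩
  intro n k hn V _ _ G _ hV hG
  obtain ⟨h1, h2⟩ := hG
  by_cases hk : n ≤ k
  · omega
  push Not at hk
  have acc : ∀ B : Finset V, B.card = k → (oddIn G B).Nonempty := by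
    intro B hB
    obtain ⟨⟨D, hD, ho, hs⟩, _⟩ := h1 B hB
    exact ⟨D, (mem_oddIn G B D).2 ⟨hD, ho, hs⟩⟩
  have wt : ∀ D : Finset V, Odd D.card → n - k + 1 ≤ (D ∪ oddNbhd G D).card := by
    intro D hD
    by_contra hlt
    obtain ⟨B, hB, hBc⟩ := Finset.exists_superset_card_eq
      (s := D ∪ oddNbhd G D) (n := n - k) (by omega) (by omega)
    exact h2 B (by rw [hBc, hV]) ⟨D, Finset.subset_union_left.trans hB, hD,
      Finset.subset_union_right.trans hB⟩
  obtain ⟨T, -, hT⟩ := Finset.exists_subset_card_eq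
    (s := (Finset.univ : Finset V)) (n := k + 1) (by rw [Finset.card_univ]; omega)
  have her : ∀ v ∈ T, (oddIn G (T.erase v)).Nonempty := fun v hv =>
    acc _ (by rw [Finset.card_erase_of_mem hv]; omega)
  have hpos : 0 < (oddIn G T).card := by
    obtain ⟨v, hv⟩ := Finset.card_pos.1 (show 0 < T.card by omega)
    obtain ⟨D, hD⟩ := her v hv
    exact Finset.card_pos.2 ⟨D, ((oddIn_erase G T D v).1 hD).1⟩
  have s1 : (k + 1) * (oddIn G T).card ≤ 4 * ∑ v ∈ T, (oddIn G (T.erase v)).card := by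
    rw [← hT, ← smul_eq_mul, ← Finset.sum_const, Finset.mul_sum]
    exact Finset.sum_le_sum fun v hv => four_mul G T v (her v hv)
  have s2 : ∑ v ∈ T, (oddIn G (T.erase v)).card
      = ∑ D ∈ oddIn G T, (T \ (D ∪ oddNbhd G D)).card := by
    have := Finset.sum_card_bipartiteAbove_eq_sum_card_bipartiteBelow
      (s := T) (t := oddIn G T) (fun v D => v ∉ D ∪ oddNbhd G D)
    convert this using 2 with v hv D hD
    · congr 1
      ext D
      simp [Finset.bipartiteAbove, oddIn_erase]
    · congr 1
      ext D
      simp [Finset.bipartiteBelow]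
  have s3 : ∑ D ∈ oddIn G T, ((T \ (D ∪ oddNbhd G D)).card + n)
      ≤ ∑ D ∈ oddIn G T, 2 * k := by
    refine Finset.sum_le_sum fun D hD => ?_
    rw [mem_oddIn] at hD
    have a := wt D hD.2.1
    have b := Finset.card_sdiff_add_card_eq_card (Finset.union_subset hD.1 hD.2.2)
    omega
  rw [Finset.sum_add_distrib, ← s2, Finset.sum_const, Finset.sum_const, smul_eq_mul,
    smul_eq_mul] at s3
  have s4 : (oddIn G T).card * (k + 1 + 4 * n) ≤ (oddIn G T).card * (8 * k) := by
    nlinarith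
  have := Nat.le_of_mul_le_mul_left s4 hpos
  omega
end
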